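/- First difference equation (3-point eigenvalue equation in the variables): for every real q with 0 < q < 1, every positive integer N, all nonzero real numbers θ, φ, all integers n₁, n₂ ≥ 0 with n₁+n₂ ≤ N, and all integers x₁, x₂ ≥ 0 with x₁+x₂ ≤ N, writing K(y₁,y₂) := K_{n₁,n₂}(y₁,y₂;θ,φ;N), one has q^{n₁} K(x₁,x₂) = [q^{x₁}(1+θ²) + q^{-1}θ² q^{-x₂} - (1+q^{-1})θ² q^{x₁-x₂}] K(x₁,x₂) + (1-θ² q^{-x₂-1})(1-q^{x₁}) K(x₁-1,x₂+1) + θ² q^{x₁-x₂}(1-q^{x₂}) K(x₁+1,x₂-1). -/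

import Mathlib

open Finset

/-- The q-Pochhammer symbol `(a;q)_n = ∏_{k=0}^{n-1} (1 - a q^k)`. -/
noncomputable def qPoch (q a : ℝ) (n : ℕ) : ℝ := ∏ k ∈ Finset.range n, (1 - a * q ^ k)

/-- The quantum q-Krawtchouk polynomial `k_n(x;p,N;q)`, defined for all integers `x, N`. -/
noncomputable def qKraw (q : ℝ) (n : ℕ) (x N : ℤ) (p : ℝ) : ℝ :=
  (-1 : ℝ) ^ n * q ^ (n * (n - 1) / 2) *
    ∑ k ∈ Finset.range (n + 1),
      qPoch q (q ^ (-(n : ℤ))) k * qPoch q (q ^ (-x)) k *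
        qPoch q (q ^ ((k : ℤ) - N)) (n - k) / qPoch q q k * (p * q ^ (n + 1)) ^ k

/-- The bivariate quantum q-Krawtchouk polynomial of Gasper and Rahman,
`K_{n₁,n₂}(x₁,x₂;θ,φ;N) = k_{n₁}(x₁;θ^{-2},x₁+x₂;q) k_{n₂}(x₁+x₂-n₁;φ^{-2},N-n₁;q)`,
with the convention that it vanishes when a degree index is negative. -/
noncomputable def Kq (q : ℝ) (n₁ n₂ x₁ x₂ : ℤ) (θ φ : ℝ) (N : ℤ) : ℝ :=
  if 0 ≤ n₁ ∧ 0 ≤ n₂ then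
    qKraw q n₁.toNat x₁ (x₁ + x₂) (θ ^ 2)⁻¹ *
      qKraw q n₂.toNat (x₁ + x₂ - n₁) (N - n₁) (φ ^ 2)⁻¹
  else 0

/-- The q-trinomial coefficient `[N; x₁, x₂]_q`. -/
noncomputable def qTrinom (q : ℝ) (N x₁ x₂ : ℕ) : ℝ :=
  qPoch q q N / (qPoch q q x₁ * qPoch q q x₂ * qPoch q q (N - x₁ - x₂))

/-- The orthogonality weight `Δ^{(N)}_{x₁,x₂}(θ,φ)`. -/
noncomputable def Δw (q : ℝ) (N x₁ x₂ : ℕ) (θ φ : ℝ) : ℝ :=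
  (-1 : ℝ) ^ (N - x₁) * (θ ^ 2 * q⁻¹) ^ (x₁ + x₂) * q ^ (x₁ * (x₁ - 1) / 2) *
    qTrinom q N x₁ x₂ * qPoch q ((θ ^ 2)⁻¹ * q) x₂ * qPoch q ((φ ^ 2)⁻¹ * q) (N - x₁ - x₂) *
    φ ^ (2 * N) * q ^ (-((N : ℤ) * (N + 1) / 2))

/-- The normalization constant `H^{(N)}_{n₁,n₂}(θ,φ)`. -/
noncomputable def Hn (q : ℝ) (N n₁ n₂ : ℕ) (θ φ : ℝ) : ℝ :=
  (-1 : ℝ) ^ (n₁ + n₂) * qPoch q (q * (θ ^ 2)⁻¹) n₁ * qPoch q (q * (φ ^ 2)⁻¹) n₂ *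
    φ ^ (2 * n₁) * (qPoch q q N / qPoch q q (N - n₁ - n₂)) ^ 2 * (qTrinom q N n₁ n₂)⁻¹ *
    q ^ (3 * ((n₁ : ℤ) * (n₁ - 1)) / 2 + 3 * ((n₂ : ℤ) * (n₂ - 1)) / 2 +
          (n₁ : ℤ) * n₂ - (N : ℤ) * (n₁ + n₂) - 2 * n₁ - n₂)

/-- The dual weight `Δ̃^{(N)}_{n₁,n₂}(θ,φ)`. -/
noncomputable def Δdual (q : ℝ) (N n₁ n₂ : ℕ) (θ φ : ℝ) : ℝ :=
  (-1 : ℝ) ^ (n₁ + n₂) * q ^ (-((n₁ : ℤ) * (n₁ - 1)) - (n₂ : ℤ) * (n₂ - 1)) *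
    φ ^ (-(2 * (n₁ : ℤ))) * (qPoch q q (N - n₁ - n₂) / qPoch q q N) ^ 2 * qTrinom q N n₁ n₂ *
    q ^ ((N : ℤ) * (n₁ + n₂) + 2 * n₁ + n₂ - (n₁ : ℤ) * n₂ -
          (n₁ : ℤ) * (n₁ - 1) / 2 - (n₂ : ℤ) * (n₂ - 1) / 2) /
    (qPoch q (q * (θ ^ 2)⁻¹) n₁ * qPoch q (q * (φ ^ 2)⁻¹) n₂)

theorem qPoch_succ (q a : ℝ) (k : ℕ) :
    qPoch q a (k + 1) = qPoch q a k * (1 - a * q ^ k) :=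
  Finset.prod_range_succ _ _

theorem qPoch_succ' (q a : ℝ) (k : ℕ) :
    qPoch q a (k + 1) = (1 - a) * qPoch q (a * q) k := by
  unfold qPoch
  rw [Finset.prod_range_succ', mul_comm, pow_zero, mul_one]
  congr 1
  exact Finset.prod_congr rfl fun i _ => by rw [pow_succ']; ring

theorem one_sub_mul_qPoch (q a : ℝ) (k : ℕ) :
    (1 - a) * qPoch q (a * q) k = qPoch q a k * (1 - a * q ^ k) := by
  rw [← qPoch_succ', qPoch_succ]

theorem qPoch_self_ne_zero {q : ℝ} (hq0 : 0 < q) (hq1 : q < 1) (k : ℕ) : qPoch q q k ≠ 0 := by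
  refine Finset.prod_ne_zero_iff.2 fun i _ => ?_
  rw [← pow_succ']
  exact (sub_pos.2 (pow_lt_one₀ hq0.le hq1 i.succ_ne_zero)).ne'

/-- The summand of the quantum q-Krawtchouk polynomial, with `q^{-x}` and `q^{-N}` replaced by
real variables `a` and `b`. -/
noncomputable def qKrawTerm (q p : ℝ) (n : ℕ) (b a : ℝ) (k : ℕ) : ℝ :=
  qPoch q (q ^ (-(n : ℤ))) k * qPoch q a k * qPoch q (q ^ k * b) (n - k) / qPoch q q k *
    (p * q ^ (n + 1)) ^ k

theorem qKraw_eq_sum_qKrawTerm {q : ℝ} (hq : q ≠ 0) (n : ℕ) (x N : ℤ) (p : ℝ) :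
    qKraw q n x N p = (-1 : ℝ) ^ n * q ^ (n * (n - 1) / 2) *
      ∑ k ∈ Finset.range (n + 1), qKrawTerm q p n (q ^ (-N)) (q ^ (-x)) k := by
  unfold qKraw qKrawTerm
  congr 1
  refine Finset.sum_congr rfl fun k _ => ?_
  rw [sub_eq_add_neg, zpow_add₀ hq, zpow_natCast]

theorem qKrawTerm_backward_shift (q p : ℝ) (n : ℕ) (b : ℝ) {a : ℝ} (ha : a ≠ 0) (k : ℕ) :
    (1 - a⁻¹) * qKrawTerm q p n b (a * q) k = (q ^ k - a⁻¹) * qKrawTerm q p n b a k := by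
  have h := one_sub_mul_qPoch q a k
  have h' : (1 - a⁻¹) * qPoch q (a * q) k = (q ^ k - a⁻¹) * qPoch q a k := by
    field_simp
    linear_combination -h
  unfold qKrawTerm
  linear_combination (qPoch q (q ^ (-(n : ℤ))) k * qPoch q (q ^ k * b) (n - k) / qPoch q q k *
    (p * q ^ (n + 1)) ^ k) * h'

theorem qKrawTerm_succ {q : ℝ} (hq0 : 0 < q) (hq1 : q < 1) (p : ℝ) {n : ℕ} {a b : ℝ}
    (ha : a ≠ 0) {k : ℕ} (hk : k < n) :
    (a⁻¹ + q⁻¹ * (b / a) - (1 + q⁻¹) * (b / a ^ 2)) * qKrawTerm q p n b a (k + 1)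
      - q⁻¹ * (b / a) * (1 - a⁻¹) * qKrawTerm q p n b (a * q) (k + 1)
      + (b / a ^ 2 - a⁻¹) * qKrawTerm q p n b (a / q) (k + 1)
    = p * (q ^ n - q ^ k) * qKrawTerm q p n b a k := by
  have hq := hq0.ne'
  have hs := qKrawTerm_backward_shift q p n b ha (k + 1)
  have hP := qPoch_self_ne_zero hq0 hq1 k
  have hP' := qPoch_self_ne_zero hq0 hq1 (k + 1)
  have hm : n - k = n - (k + 1) + 1 := by omega
  have e1 : qPoch q (q ^ k * b) (n - k) =
      (1 - q ^ k * b) * qPoch q (q ^ (k + 1) * b) (n - (k + 1)) := by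
    rw [hm, qPoch_succ', show q ^ k * b * q = q ^ (k + 1) * b by ring]
  have e2 : qPoch q (a / q) (k + 1) = (1 - a / q) * qPoch q a k := by
    rw [qPoch_succ', div_mul_cancel₀ _ hq]
  have e3 : (1 - q * q ^ k) ≠ 0 := by
    rw [qPoch_succ] at hP'
    exact right_ne_zero_of_mul hP'
  rw [mul_assoc (q⁻¹ * (b / a)), hs]
  unfold qKrawTerm
  rw [e1, e2, qPoch_succ q (q ^ (-(n : ℤ))), qPoch_succ q a, qPoch_succ q q, zpow_neg, zpow_natCast]
  field_simp
  ring

/-- The difference equation of the quantum q-Krawtchouk polynomials, as an identity for the sum of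
their terms in the variables `a = q^{-x}` and `b = q^{-N}`. -/
theorem sum_qKrawTerm_difference {q : ℝ} (hq0 : 0 < q) (hq1 : q < 1) (p : ℝ) (n : ℕ) {a b : ℝ}
    (ha : a ≠ 0) :
    p * q ^ n * ∑ k ∈ Finset.range (n + 1), qKrawTerm q p n b a k =
      (p * a⁻¹ + a⁻¹ + q⁻¹ * (b / a) - (1 + q⁻¹) * (b / a ^ 2)) *
        ∑ k ∈ Finset.range (n + 1), qKrawTerm q p n b a k
      + (p - q⁻¹ * (b / a)) * (1 - a⁻¹) *
        ∑ k ∈ Finset.range (n + 1), qKrawTerm q p n b (a * q) k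
      + (b / a ^ 2 - a⁻¹) * ∑ k ∈ Finset.range (n + 1), qKrawTerm q p n b (a / q) k := by
  have hL : ∑ k ∈ Finset.range (n + 1), (p * (q ^ n - a⁻¹) * qKrawTerm q p n b a k
      - p * (1 - a⁻¹) * qKrawTerm q p n b (a * q) k)
      = ∑ k ∈ Finset.range n, p * (q ^ n - q ^ k) * qKrawTerm q p n b a k := by
    have h (k : ℕ) : p * (q ^ n - a⁻¹) * qKrawTerm q p n b a k
        - p * (1 - a⁻¹) * qKrawTerm q p n b (a * q) k
        = p * (q ^ n - q ^ k) * qKrawTerm q p n b a k := by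
      linear_combination -p * qKrawTerm_backward_shift q p n b ha k
    simp only [h, Finset.sum_range_succ, sub_self, mul_zero, zero_mul, add_zero]
  have hR : ∑ k ∈ Finset.range (n + 1),
      ((a⁻¹ + q⁻¹ * (b / a) - (1 + q⁻¹) * (b / a ^ 2)) * qKrawTerm q p n b a k
      - q⁻¹ * (b / a) * (1 - a⁻¹) * qKrawTerm q p n b (a * q) k
      + (b / a ^ 2 - a⁻¹) * qKrawTerm q p n b (a / q) k)
      = ∑ k ∈ Finset.range n, p * (q ^ n - q ^ k) * qKrawTerm q p n b a k := by
    rw [Finset.sum_range_succ', Finset.sum_congr rfl fun k hk =>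
      qKrawTerm_succ hq0 hq1 p ha (Finset.mem_range.1 hk)]
    simp only [qKrawTerm, qPoch, Finset.range_zero, Finset.prod_empty]
    ring
  have h := hL.trans hR.symm
  simp only [Finset.sum_add_distrib, Finset.sum_sub_distrib, ← Finset.mul_sum] at h
  linear_combination h

/-- The difference equation of the quantum q-Krawtchouk polynomials. -/
theorem qKraw_difference {q : ℝ} (hq0 : 0 < q) (hq1 : q < 1) (p : ℝ) (n : ℕ) (x N : ℤ) :
    p * q ^ n * qKraw q n x N p =
      (p * q ^ x + q ^ x + q⁻¹ * q ^ (x - N) - (1 + q⁻¹) * q ^ (2 * x - N)) * qKraw q n x N p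
      + (p - q⁻¹ * q ^ (x - N)) * (1 - q ^ x) * qKraw q n (x - 1) N p
      + (q ^ (2 * x - N) - q ^ x) * qKraw q n (x + 1) N p := by
  have hq := hq0.ne'
  have h := sum_qKrawTerm_difference hq0 hq1 p n (b := q ^ (-N)) (zpow_ne_zero (-x) hq)
  have e1 : (q ^ (-x))⁻¹ = q ^ x := by rw [zpow_neg, inv_inv]
  have e2 : q ^ (-N) / q ^ (-x) = q ^ (x - N) := by
    rw [← zpow_sub₀ hq]; ring_nf
  have e3 : q ^ (-N) / (q ^ (-x)) ^ 2 = q ^ (2 * x - N) := by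
    rw [← zpow_natCast, ← zpow_mul, ← zpow_sub₀ hq]; congr 1; push_cast; ring
  have e4 : q ^ (-x) * q = q ^ (-(x - 1)) := by
    rw [← zpow_add_one₀ hq]; ring_nf
  have e5 : q ^ (-x) / q = q ^ (-(x + 1)) := by
    rw [div_eq_mul_inv, ← zpow_sub_one₀ hq]; ring_nf
  rw [e1, e2, e3, e4, e5] at h
  simp only [qKraw_eq_sum_qKrawTerm hq]
  linear_combination ((-1 : ℝ) ^ n * q ^ (n * (n - 1) / 2)) * h

/-- First difference equation (3-point eigenvalue equation in the variables). -/
theorem first_difference_equation (q : ℝ) (hq0 : 0 < q) (hq1 : q < 1)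
    (N : ℕ) (hN : 0 < N) (θ φ : ℝ) (hθ : θ ≠ 0) (hφ : φ ≠ 0)
    (n₁ n₂ : ℕ) (hn : n₁ + n₂ ≤ N) (x₁ x₂ : ℕ) (hx : x₁ + x₂ ≤ N) :
    q ^ n₁ * Kq q n₁ n₂ x₁ x₂ θ φ N
    = (q ^ x₁ * (1 + θ ^ 2) + q⁻¹ * θ ^ 2 * q ^ (-(x₂ : ℤ))
        - (1 + q⁻¹) * θ ^ 2 * q ^ ((x₁ : ℤ) - x₂)) * Kq q n₁ n₂ x₁ x₂ θ φ N
      + (1 - θ ^ 2 * q ^ (-(x₂ : ℤ) - 1)) * (1 - q ^ x₁) *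
        Kq q n₁ n₂ ((x₁ : ℤ) - 1) ((x₂ : ℤ) + 1) θ φ N
      + θ ^ 2 * q ^ ((x₁ : ℤ) - x₂) * (1 - q ^ x₂) *
        Kq q n₁ n₂ ((x₁ : ℤ) + 1) ((x₂ : ℤ) - 1) θ φ N := by
  have hq := hq0.ne'
  have h := qKraw_difference hq0 hq1 (θ ^ 2)⁻¹ n₁ x₁ (x₁ + x₂)
  have e1 : (x₁ : ℤ) - (x₁ + x₂) = -x₂ := by ring
  have e2 : 2 * (x₁ : ℤ) - (x₁ + x₂) = x₁ - x₂ := by ring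
  have e3 : (x₁ : ℤ) - 1 + (x₂ + 1) = x₁ + x₂ := by ring
  have e4 : (x₁ : ℤ) + 1 + (x₂ - 1) = x₁ + x₂ := by ring
  have e5 : q ^ (-(x₂ : ℤ) - 1) = q⁻¹ * q ^ (-(x₂ : ℤ)) := by
    rw [zpow_sub_one₀ hq, mul_comm]
  have e6 : q ^ ((x₁ : ℤ) - x₂) * q ^ x₂ = q ^ x₁ := by
    rw [← zpow_natCast q x₂, ← zpow_add₀ hq, sub_add_cancel, zpow_natCast]
  have e7 : θ ^ 2 * (θ ^ 2)⁻¹ = 1 := mul_inv_cancel₀ (pow_ne_zero 2 hθ)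
  rw [e1, e2, zpow_natCast] at h
  simp only [Kq, Int.natCast_nonneg, and_self, if_true, Int.toNat_natCast, e3, e4, e5]
  generalize qKraw q n₂ _ _ _ = Z
  generalize qKraw q n₁ ((x₁ : ℤ) - 1) _ _ = A at *
  generalize qKraw q n₁ ((x₁ : ℤ) + 1) _ _ = B at *
  generalize qKraw q n₁ (x₁ : ℤ) _ _ = C at *
  linear_combination (θ ^ 2 * Z) * h + θ ^ 2 * B * Z * e6
    + (q ^ x₁ * C + (1 - q ^ x₁) * A - q ^ n₁ * C) * Z * e7
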